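/- arXiv:2110.07946 — 2 statements merged into one kernel-verified Lean document; each statement's English description precedes it below -/
import Mathlib

section
/- Let p(x) = x1^3 + 3(-x2^2 + a x3^2) x1 + (3b x2 + d x3) x3^2 be a homogeneous cubic on ℝ^3. Then p ≤ 1 on the unit sphere S^2 if and only if 1 + a + √3 b ≥ 0, 1 + a - √3 b ≥ 0, 1 - 2a ≥ 0, and (1 + a + √3 b)(1 + a - √3 b)(1 - 2a) ≥ d^2. -/
open Set

/-- A traceless real symmetric `3 × 3` matrix whose squared Frobenius norm is `6` has
determinant at most `2`. -/
theorem det_le_two_of_traceless (p q r u v w : ℝ) (htr : p + q + r = 0)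
    (hsq : p ^ 2 + q ^ 2 + r ^ 2 + 2 * (u ^ 2 + v ^ 2 + w ^ 2) = 6) :
    p * q * r + 2 * (u * v * w) - p * u ^ 2 - q * v ^ 2 - r * w ^ 2 ≤ 2 := by
  set N : Matrix (Fin 3) (Fin 3) ℝ := !![p, w, v; w, q, u; v, u, r] with hN_def
  have hN : N.IsHermitian := by
    ext i j
    fin_cases i <;> fin_cases j <;> simp [hN_def, Matrix.conjTranspose_apply]
  have htrace := hN.trace_eq_sum_eigenvalues
  have hdet := hN.det_eq_prod_eigenvalues
  have hchar := congrArg (Polynomial.eval 1) hN.charpoly_eq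
  rw [Matrix.eval_charpoly] at hchar
  generalize hN.eigenvalues = e at htrace hdet hchar
  simp [Fin.sum_univ_three, Fin.prod_univ_three, Matrix.trace, Matrix.det_fin_three, hN_def]
    at htrace hdet hchar
  generalize e 0 = x at htrace hdet hchar
  generalize e 1 = y at htrace hdet hchar
  generalize e 2 = z at htrace hdet hchar
  obtain rfl : r = -p - q := by linarith
  obtain rfl : z = -x - y := by linarith
  have he : x ^ 2 + x * y + y ^ 2 = 3 := by linarith
  have hx : x ≤ 2 := by nlinarith [sq_nonneg (x + 2 * y)]
  have hxyz : x * y * (-x - y) = x ^ 3 - 3 * x := by linear_combination (-x) * he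
  nlinarith [mul_nonneg (sub_nonneg.2 hx) (sq_nonneg (x + 1))]

/-- The cubic in the coordinates `⟨uᵢ, x⟩`, where `u₁, u₂, u₃` are its maximizers in the plane
`x3 = 0`. -/
theorem cubic_eq (a b d x1 x2 x3 : ℝ) :
    x1^3 + 3*(-x2^2 + a*x3^2)*x1 + (3*b*x2 + d*x3)*x3^2 =
      4 * (x1 * (-x1 / 2 - √3 / 2 * x2) * (-x1 / 2 + √3 / 2 * x2))
        - x3 ^ 2 * ((1 - 2 * a) * x1 + (1 + a + √3 * b) * (-x1 / 2 - √3 / 2 * x2)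
          + (1 + a - √3 * b) * (-x1 / 2 + √3 / 2 * x2)) + d * x3 ^ 3 := by
  have h3 : √3 ^ 2 = (3 : ℝ) := Real.sq_sqrt (by norm_num)
  linear_combination (x1 * x2 ^ 2 - x3 ^ 2 * b * x2) * h3

theorem cubic_le_one (a b d : ℝ) (hB : 0 ≤ 1 + a + √3 * b) (hC : 0 ≤ 1 + a - √3 * b)
    (hA : 0 ≤ 1 - 2 * a)
    (hd : d ^ 2 ≤ (1 + a + √3 * b) * (1 + a - √3 * b) * (1 - 2 * a))
    (x1 x2 x3 : ℝ) (hx : x1 ^ 2 + x2 ^ 2 + x3 ^ 2 = 1) :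
    x1^3 + 3*(-x2^2 + a*x3^2)*x1 + (3*b*x2 + d*x3)*x3^2 ≤ 1 := by
  have h3 : √3 ^ 2 = (3 : ℝ) := Real.sq_sqrt (by norm_num)
  rw [cubic_eq]
  have hsum : (1 - 2 * a) + (1 + a + √3 * b) + (1 + a - √3 * b) = 3 := by ring
  generalize 1 - 2 * a = A at *
  generalize 1 + a + √3 * b = B at *
  generalize 1 + a - √3 * b = C at *
  have hα := Real.sq_sqrt hA
  have hβ := Real.sq_sqrt hB
  have hγ := Real.sq_sqrt hC
  have hz := sq_abs x3
  have hdz : d * x3 ^ 3 ≤ √A * √B * √C * |x3| ^ 3 := by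
    have hd' : |d| ≤ √A * √B * √C := by
      refine abs_le_of_sq_le_sq ?_ (by positivity)
      calc d ^ 2 ≤ B * C * A := hd
        _ = (√A * √B * √C) ^ 2 := by rw [mul_pow, mul_pow, hα, hβ, hγ]; ring
    calc d * x3 ^ 3 ≤ |d * x3 ^ 3| := le_abs_self _
      _ = |d| * |x3| ^ 3 := by rw [abs_mul, abs_pow]
      _ ≤ _ := by gcongr
  have key := det_le_two_of_traceless (2 * x1) (2 * (-x1 / 2 - √3 / 2 * x2))
    (2 * (-x1 / 2 + √3 / 2 * x2)) (√A * |x3|) (√B * |x3|) (√C * |x3|) (by ring) (by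
      simp only [mul_pow, hα, hβ, hγ, hz]
      linear_combination 6 * hx + 2 * x3 ^ 2 * hsum + 2 * x2 ^ 2 * h3)
  simp only [mul_pow, hα, hβ, hγ, hz] at key
  linarith

/-- If the cubic is at most `1` on the sphere and the second-order conditions at its three known
maximizers are strict, then `d` satisfies the discriminant bound. -/
theorem sq_le_of_cubic_le_one (a b d : ℝ) (hB : 0 < 1 + a + √3 * b) (hC : 0 < 1 + a - √3 * b)
    (hA : 0 < 1 - 2 * a)
    (h : ∀ x1 x2 x3 : ℝ, x1^2 + x2^2 + x3^2 = 1 →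
      x1^3 + 3*(-x2^2 + a*x3^2)*x1 + (3*b*x2 + d*x3)*x3^2 ≤ 1) :
    d ^ 2 ≤ (1 + a + √3 * b) * (1 + a - √3 * b) * (1 - 2 * a) := by
  have h3 : √3 ^ 2 = (3 : ℝ) := Real.sq_sqrt (by norm_num)
  have h3' : √3 ≠ 0 := by positivity
  simp only [cubic_eq] at h
  have hsum : (1 - 2 * a) = 3 - (1 + a + √3 * b) - (1 + a - √3 * b) := by ring
  generalize 1 - 2 * a = A at *
  generalize 1 + a + √3 * b = B at *
  generalize 1 + a - √3 * b = C at *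
  have hD2 : √(B * C * A) ^ 2 = B * C * A := Real.sq_sqrt (by positivity)
  have hD : 0 < √(B * C * A) := Real.sqrt_pos.2 (by positivity)
  generalize √(B * C * A) = D at *
  obtain ⟨E, hE⟩ : ∃ E, E = A * B + B * C + C * A := ⟨_, rfl⟩
  have hE0 : 0 < E := by rw [hE]; positivity
  have main : ∀ z : ℝ, z ^ 2 = (3 * D / E) ^ 2 → d * z ^ 3 ≤ D * (3 * D / E) ^ 3 := by
    intro z hz
    have hz2 : z ^ 2 = 9 * (B * C * A) / E ^ 2 := by rw [hz, div_pow, mul_pow, hD2]; norm_num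
    have hDz : D * (3 * D / E) ^ 3 = 27 * (B * C * A) ^ 2 / E ^ 3 := by
      rw [← hD2]; field_simp; norm_num
    have e2 : -((3 * B * C - E) / (2 * E)) / 2 - √3 / 2 * (3 * A * (B - C) / (2 * E) / √3)
        = (3 * C * A - E) / (2 * E) := by
      field_simp; rw [hE]; ring
    have e3 : -((3 * B * C - E) / (2 * E)) / 2 + √3 / 2 * (3 * A * (B - C) / (2 * E) / √3)
        = (3 * A * B - E) / (2 * E) := by
      field_simp; rw [hE]; ring
    have := h ((3 * B * C - E) / (2 * E)) (3 * A * (B - C) / (2 * E) / √3) z (by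
      rw [hz2, div_pow _ √3, h3]
      field_simp
      rw [hE, hsum]; ring)
    rw [e2, e3, hz2] at this
    have e : 4 * ((3 * B * C - E) / (2 * E) * ((3 * C * A - E) / (2 * E)) *
        ((3 * A * B - E) / (2 * E))) - 9 * (B * C * A) / E ^ 2 * (A * ((3 * B * C - E) / (2 * E))
        + B * ((3 * C * A - E) / (2 * E)) + C * ((3 * A * B - E) / (2 * E)))
        = 1 - 27 * (B * C * A) ^ 2 / E ^ 3 := by
      field_simp
      rw [hE, hsum]; ring
    linarith
  have hz0 : 0 < (3 * D / E) ^ 3 := by positivity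
  have hle := le_of_mul_le_mul_right (main _ rfl) hz0
  have hge : -d ≤ D := le_of_mul_le_mul_right (by linarith [main (-(3 * D / E)) (by ring)]) hz0
  rw [← hD2]
  exact sq_le_sq' (by linarith) hle

theorem nonneg_at_one_of_nonneg_Ioo {f : ℝ → ℝ} (hf : Continuous f)
    (h : ∀ s ∈ Ioo (0 : ℝ) 1, 0 ≤ f s) : 0 ≤ f 1 := by
  have hcl : closure (Ioo (0 : ℝ) 1) ⊆ {s | 0 ≤ f s} :=
    closure_minimal h (isClosed_le continuous_const hf)
  exact hcl (by rw [closure_Ioo zero_ne_one]; exact ⟨zero_le_one, le_rfl⟩)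

/-- The second-order condition at a unit vector `(v1, v2, 0)` where the cubic equals `1`. -/
theorem second_order_of_cubic_le_one {a b d v1 v2 : ℝ} (hv : v1 ^ 2 + v2 ^ 2 = 1)
    (hmax : v1 ^ 3 - 3 * v2 ^ 2 * v1 = 1)
    (h : ∀ x1 x2 x3 : ℝ, x1^2 + x2^2 + x3^2 = 1 →
      x1^3 + 3*(-x2^2 + a*x3^2)*x1 + (3*b*x2 + d*x3)*x3^2 ≤ 1) :
    0 ≤ 1 - 2 * (a * v1 + b * v2) := by
  have key := nonneg_at_one_of_nonneg_Ioo
    (f := fun c ↦ 1 + c + c ^ 2 - 3 * (a * v1 + b * v2) * c * (1 + c)) (by fun_prop) (by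
      rintro c ⟨hc0, hc1⟩
      have hz : √(1 - c ^ 2) ^ 2 = 1 - c ^ 2 := Real.sq_sqrt (by nlinarith)
      generalize √(1 - c ^ 2) = z at hz
      have h1 := h (c * v1) (c * v2) z (by linear_combination c ^ 2 * hv + hz)
      have h2 := h (c * v1) (c * v2) (-z) (by linear_combination c ^ 2 * hv + hz)
      have h4 : c ^ 3 + 3 * (a * v1 + b * v2) * c * z ^ 2 ≤ 1 := by
        linear_combination h1 / 2 + h2 / 2 - c ^ 3 * hmax
      rw [hz] at h4
      refine nonneg_of_mul_nonneg_right ?_ (sub_pos.2 hc1)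
      linarith)
  norm_num at key
  linarith

theorem stmt_13 (a b d : ℝ) :
    (∀ x1 x2 x3 : ℝ, x1^2 + x2^2 + x3^2 = 1 →
        x1^3 + 3*(-x2^2 + a*x3^2)*x1 + (3*b*x2 + d*x3)*x3^2 ≤ 1) ↔
      (1 + a + Real.sqrt 3 * b ≥ 0 ∧ 1 + a - Real.sqrt 3 * b ≥ 0 ∧ 1 - 2*a ≥ 0 ∧
        (1 + a + Real.sqrt 3 * b) * (1 + a - Real.sqrt 3 * b) * (1 - 2*a) ≥ d^2) := by
  refine ⟨fun h ↦ ?_, fun ⟨hB, hC, hA, hd⟩ ↦ cubic_le_one a b d hB hC hA hd⟩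
  have h3 : √3 ^ 2 = (3 : ℝ) := Real.sq_sqrt (by norm_num)
  have hA : 0 ≤ 1 - 2 * a := by
    have := second_order_of_cubic_le_one (v1 := 1) (v2 := 0) (by norm_num) (by norm_num) h
    linarith
  have hB : 0 ≤ 1 + a + √3 * b := by
    have := second_order_of_cubic_le_one (v1 := -1 / 2) (v2 := -√3 / 2)
      (by linear_combination h3 / 4) (by linear_combination 3 / 8 * h3) h
    linarith
  have hC : 0 ≤ 1 + a - √3 * b := by
    have := second_order_of_cubic_le_one (v1 := -1 / 2) (v2 := √3 / 2)
      (by linear_combination h3 / 4) (by linear_combination 3 / 8 * h3) h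
    linarith
  refine ⟨hB, hC, hA, ?_⟩
  have key := nonneg_at_one_of_nonneg_Ioo
    (f := fun s ↦ (1 + s * a + √3 * (s * b)) * (1 + s * a - √3 * (s * b)) * (1 - 2 * (s * a))
      - (s * d) ^ 2) (by fun_prop) (by
      rintro s ⟨hs0, hs1⟩
      refine sub_nonneg.2 (sq_le_of_cubic_le_one (s * a) (s * b) (s * d) ?_ ?_ ?_ ?_)
      · linarith [mul_nonneg hs0.le hB]
      · linarith [mul_nonneg hs0.le hC]
      · linarith [mul_nonneg hs0.le hA]
      · intro x1 x2 x3 hx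
        have h0 := cubic_le_one 0 0 0 (by norm_num) (by norm_num) (by norm_num) (by norm_num)
          x1 x2 x3 hx
        have h1 := h x1 x2 x3 hx
        linarith [mul_le_mul_of_nonneg_left h0 (sub_nonneg.2 hs1.le),
          mul_le_mul_of_nonneg_left h1 hs0.le])
  simp only [one_mul] at key
  linarith
end

section
/- Let b1, b2, b3 > 0 and let Γ be the 4×4 symmetric matrix with unit diagonal, Γ_ij = -1/2 + (3/2)/((b_i^{-1}+1)(b_j^{-1}+1)) for 1 ≤ i < j ≤ 3, and Γ_i4 = -1/2 + (3/2)(b1+b2+b3+1)b_i/((b1+b2+b3)(b_i+1)) for i = 1,2,3. Then all off-diagonal entries of Γ lie in (-1/2, 1), Γ is positive semidefinite, and det Γ = 0. -/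
/-- The quadratic form of the Gramian on the first three vectors, in coordinates rescaled by
`b_i + 1`, is nonnegative. -/
lemma wing_quadratic_form_nonneg {a b c : ℝ} (ha : 0 < a) (hb : 0 < b) (hc : 0 < c)
    (x y z : ℝ) :
    0 ≤ 3 * ((a * x + b * y + c * z) ^ 2
        + ((2 * a + 1) * x ^ 2 + (2 * b + 1) * y ^ 2 + (2 * c + 1) * z ^ 2))
      - ((a + 1) * x + (b + 1) * y + (c + 1) * z) ^ 2 := by
  have aux (u v : ℝ) : 0 ≤ 8 * u ^ 2 + 8 * v ^ 2 + 2 * u * v := by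
    nlinarith [sq_nonneg (u + v), sq_nonneg u, sq_nonneg v]
  have hs : 0 < (a + b + c) ^ 2 := by positivity
  refine nonneg_of_mul_nonneg_right ?_ hs
  set Y := x + y + z with hY
  set u := 3 * x - Y with hu
  set v := 3 * y - Y with hv
  set w := 3 * z - Y with hw
  have h1 : 0 ≤ a ^ 2 * (v - w) ^ 2 + b ^ 2 * (u - w) ^ 2 + c ^ 2 * (u - v) ^ 2
      + a * b * (8 * u ^ 2 + 8 * v ^ 2 + 2 * u * v)
      + a * c * (8 * u ^ 2 + 8 * w ^ 2 + 2 * u * w)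
      + b * c * (8 * v ^ 2 + 8 * w ^ 2 + 2 * v * w) := by
    have := aux u v
    have := aux u w
    have := aux v w
    positivity
  have h2 : 0 ≤ (a + b + c) * (a * b * (u - v) ^ 2 + a * c * (u - w) ^ 2
      + b * c * (v - w) ^ 2) := by positivity
  have h3 := sq_nonneg ((a + b + c) ^ 2 * Y + (a + b + c + 3 / 2) * (a * u + b * v + c * w))
  simp only [hu, hv, hw, hY] at h1 h2 h3
  linear_combination (2 / 9) * h3 + (2 / 3) * h2 + (1 / 6) * h1


theorem stmt_17 (b1 b2 b3 : ℝ) (h1 : 0 < b1) (h2 : 0 < b2) (h3 : 0 < b3)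
    (Γ : Matrix (Fin 4) (Fin 4) ℝ)
    (hΓ : Γ = !![1,
        -1/2 + (3/2)/((b1⁻¹ + 1)*(b2⁻¹ + 1)),
        -1/2 + (3/2)/((b1⁻¹ + 1)*(b3⁻¹ + 1)),
        -1/2 + (3/2)*(b1 + b2 + b3 + 1)*b1/((b1 + b2 + b3)*(b1 + 1));
        -1/2 + (3/2)/((b1⁻¹ + 1)*(b2⁻¹ + 1)),
        1,
        -1/2 + (3/2)/((b2⁻¹ + 1)*(b3⁻¹ + 1)),
        -1/2 + (3/2)*(b1 + b2 + b3 + 1)*b2/((b1 + b2 + b3)*(b2 + 1));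
        -1/2 + (3/2)/((b1⁻¹ + 1)*(b3⁻¹ + 1)),
        -1/2 + (3/2)/((b2⁻¹ + 1)*(b3⁻¹ + 1)),
        1,
        -1/2 + (3/2)*(b1 + b2 + b3 + 1)*b3/((b1 + b2 + b3)*(b3 + 1));
        -1/2 + (3/2)*(b1 + b2 + b3 + 1)*b1/((b1 + b2 + b3)*(b1 + 1)),
        -1/2 + (3/2)*(b1 + b2 + b3 + 1)*b2/((b1 + b2 + b3)*(b2 + 1)),
        -1/2 + (3/2)*(b1 + b2 + b3 + 1)*b3/((b1 + b2 + b3)*(b3 + 1)),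
        1]) :
    (∀ i j, i ≠ j → Γ i j ∈ Set.Ioo (-1/2 : ℝ) 1) ∧ Γ.PosSemidef ∧ Γ.det = 0 := by
  have hs : 0 < b1 + b2 + b3 := by positivity
  have off {a b : ℝ} (ha : 0 < a) (hb : 0 < b) :
      -1/2 + (3/2)/((a⁻¹ + 1)*(b⁻¹ + 1)) ∈ Set.Ioo (-1/2 : ℝ) 1 := by
    have ha' : 0 < a⁻¹ := inv_pos.2 ha
    have hb' : 0 < b⁻¹ := inv_pos.2 hb
    have hpos : 0 < (3/2)/((a⁻¹ + 1)*(b⁻¹ + 1)) := by positivity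
    have hlt : (3/2)/((a⁻¹ + 1)*(b⁻¹ + 1)) < 3/2 := by
      rw [div_lt_iff₀ (by positivity)]
      nlinarith [mul_pos ha' hb']
    exact ⟨by linarith, by linarith⟩
  have last {a : ℝ} (ha : 0 < a) (has : a < b1 + b2 + b3) :
      -1/2 + (3/2)*(b1 + b2 + b3 + 1)*a/((b1 + b2 + b3)*(a + 1)) ∈ Set.Ioo (-1/2 : ℝ) 1 := by
    have hpos : 0 < (3/2)*(b1 + b2 + b3 + 1)*a/((b1 + b2 + b3)*(a + 1)) := by positivity
    have hlt : (3/2)*(b1 + b2 + b3 + 1)*a/((b1 + b2 + b3)*(a + 1)) < 3/2 := by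
      rw [div_lt_iff₀ (by positivity)]
      nlinarith
    exact ⟨by linarith, by linarith⟩
  refine ⟨?_, ?_, ?_⟩
  · have h12 := off h1 h2
    have h13 := off h1 h3
    have h23 := off h2 h3
    have h14 := last h1 (by linarith)
    have h24 := last h2 (by linarith)
    have h34 := last h3 (by linarith)
    intro i j hij
    subst hΓ
    fin_cases i <;> fin_cases j <;> first | exact absurd rfl hij | assumption
  · refine Matrix.PosSemidef.of_dotProduct_mulVec_nonneg ?_ fun x => ?_
    · subst hΓ
      ext i j
      fin_cases i <;> fin_cases j <;> rfl
    · set t := x 3 / (b1 + b2 + b3) with ht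
      have hQ := wing_quadratic_form_nonneg h1 h2 h3
        (x 0 / (b1 + 1) + t) (x 1 / (b2 + 1) + t) (x 2 / (b3 + 1) + t)
      refine (mul_nonneg one_half_pos.le hQ).trans_eq ?_
      subst hΓ
      simp only [Matrix.mulVec, dotProduct, Fin.sum_univ_four, Pi.star_apply, star_trivial,
        Matrix.of_apply, Matrix.cons_val, ht]
      field_simp
      ring
  · refine Matrix.exists_mulVec_eq_zero_iff.1
      ⟨![b1 + 1, b2 + 1, b3 + 1, -(b1 + b2 + b3)], fun h => ?_, ?_⟩
    · have h0 : b1 + 1 = 0 := congrFun h 0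
      linarith
    · subst hΓ
      ext i
      fin_cases i <;>
        simp only [Matrix.mulVec, dotProduct, Fin.sum_univ_four, Matrix.of_apply,
          Matrix.cons_val, Pi.zero_apply, Fin.zero_eta, Fin.mk_one, Fin.reduceFinMk] <;>
        field_simp <;> ring
end
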